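/- Let D ⊂ ℝ^d be a nonempty open set. Let x^n, x be continuous paths from [0,∞) to ℝ^d with x^n → x uniformly on compact subsets of [0,∞), and with x(0) ∈ D and x^n(0) ∈ D for all n. Suppose that there do not exist t > 0 and ε > 0 such that x(t) ∈ ∂D and x(s) ∈ cl(D) for all s ∈ (t, t+ε). Then τ(x^n) → τ(x) as n → ∞ (convergence in [0,∞]). -/

import Mathlib

open MeasureTheory Filter Set ENNReal

/-- The first exit time of a path `x` from `D`, as an element of `[0,∞]`,
with the convention `inf ∅ = ∞`. -/
noncomputable def exitTime {d : ℕ} (D : Set (EuclideanSpace ℝ (Fin d)))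
    (x : ℝ → EuclideanSpace ℝ (Fin d)) : ℝ≥0∞ :=
  sInf {t : ℝ≥0∞ | t ≠ ⊤ ∧ x t.toReal ∉ D}

/-- If a path stays in an open set `D` on a compact set `K`, then so do all uniformly close paths. -/
theorem eventually_forall_mem_of_tendstoUniformlyOn {ι α E : Type*} [TopologicalSpace α]
    [PseudoMetricSpace E] {l : Filter ι} {K : Set α} (hK : IsCompact K) {D : Set E}
    (hD : IsOpen D) {f : α → E} {F : ι → α → E} (hf : ContinuousOn f K)
    (hconv : TendstoUniformlyOn F f l K) (hmem : ∀ t ∈ K, f t ∈ D) :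
    ∀ᶠ n in l, ∀ t ∈ K, F n t ∈ D := by
  obtain ⟨δ, hδ, hsub⟩ := (hK.image_of_continuousOn hf).exists_thickening_subset_open hD
    (image_subset_iff.2 hmem)
  filter_upwards [Metric.tendstoUniformlyOn_iff.1 hconv δ hδ] with n hn t ht
  exact hsub (Metric.mem_thickening_iff.2 ⟨f t, mem_image_of_mem f ht, dist_comm (f t) _ ▸ hn t ht⟩)

theorem exitTime_le_ofReal {d : ℕ} {D : Set (EuclideanSpace ℝ (Fin d))}
    {x : ℝ → EuclideanSpace ℝ (Fin d)} {s : ℝ} (hs : 0 ≤ s) (hxs : x s ∉ D) :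
    exitTime D x ≤ ENNReal.ofReal s :=
  sInf_le ⟨ofReal_ne_top, by rwa [toReal_ofReal hs]⟩

theorem mem_of_lt_exitTime {d : ℕ} {D : Set (EuclideanSpace ℝ (Fin d))}
    {x : ℝ → EuclideanSpace ℝ (Fin d)} {s : ℝ} (hs : 0 ≤ s)
    (h : ENNReal.ofReal s < exitTime D x) : x s ∈ D := by
  by_contra hxs
  exact (exitTime_le_ofReal hs hxs).not_gt h

theorem le_exitTime_of_forall_mem {d : ℕ} {D : Set (EuclideanSpace ℝ (Fin d))}
    {x : ℝ → EuclideanSpace ℝ (Fin d)} {T : ℝ} (h : ∀ t ∈ Icc 0 T, x t ∈ D) :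
    ENNReal.ofReal T ≤ exitTime D x := by
  refine le_sInf fun t ⟨ht, hxt⟩ => ?_
  by_contra! hlt
  exact hxt (h _ ⟨toReal_nonneg, (lt_ofReal_iff_toReal_lt ht).1 hlt |>.le⟩)

/-- Without grazing, a path leaves the closure of `D` arbitrarily soon after its exit time. -/
theorem exists_notMem_closure_of_exitTime_lt {d : ℕ} {D : Set (EuclideanSpace ℝ (Fin d))}
    (hD : IsOpen D) {x : ℝ → EuclideanSpace ℝ (Fin d)} (h0 : x 0 ∈ D)
    (hgraze : ¬ ∃ t > (0:ℝ), ∃ ε > (0:ℝ), x t ∈ frontier D ∧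
      ∀ s ∈ Ioo t (t + ε), x s ∈ closure D)
    {a : ℝ≥0∞} (ha : exitTime D x < a) :
    ∃ s : ℝ, 0 < s ∧ ENNReal.ofReal s < a ∧ x s ∉ closure D := by
  obtain ⟨t, ⟨ht, hxt⟩, hta⟩ := sInf_lt_iff.1 ha
  obtain ⟨b, htb, hba⟩ := exists_between hta
  have hb : b ≠ ⊤ := hba.ne_top
  have hpos : 0 < t.toReal := by
    refine toReal_nonneg.lt_of_ne fun h => hxt ?_
    rwa [← h]
  have htb' : t.toReal < b.toReal := (toReal_lt_toReal ht hb).2 htb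
  by_cases hcl : x t.toReal ∈ closure D
  · by_contra! hcon
    refine hgraze ⟨t.toReal, hpos, b.toReal - t.toReal, sub_pos.2 htb',
      hD.frontier_eq ▸ ⟨hcl, hxt⟩, fun s hs => hcon s (hpos.trans hs.1) ?_⟩
    refine lt_of_le_of_lt (ofReal_le_of_le_toReal ?_) hba
    linarith [hs.2]
  · exact ⟨t.toReal, hpos, by rwa [ofReal_toReal ht], hcl⟩

theorem stmt8 {d : ℕ} (D : Set (EuclideanSpace ℝ (Fin d)))
    (hD : IsOpen D) (hne : D.Nonempty)
    (x : ℝ → EuclideanSpace ℝ (Fin d)) (xn : ℕ → ℝ → EuclideanSpace ℝ (Fin d))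
    (hx : ContinuousOn x (Ici 0)) (hxn : ∀ n, ContinuousOn (xn n) (Ici 0))
    (hconv : ∀ T > (0:ℝ), TendstoUniformlyOn (fun n t => xn n t) x atTop (Icc 0 T))
    (h0 : x 0 ∈ D) (h0n : ∀ n, xn n 0 ∈ D)
    (hgraze : ¬ ∃ t > (0:ℝ), ∃ ε > (0:ℝ), x t ∈ frontier D ∧
      ∀ s ∈ Ioo t (t + ε), x s ∈ closure D) :
    Filter.Tendsto (fun n => exitTime D (xn n)) Filter.atTop (nhds (exitTime D x)) := by
  refine tendsto_order.2 ⟨fun a ha => ?_, fun a ha => ?_⟩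
  · obtain ⟨b, hab, hb⟩ := exists_between ha
    have hbtop : b ≠ ⊤ := hb.ne_top
    have hbpos : 0 < b.toReal := toReal_pos (ne_bot_of_gt hab) hbtop
    have hmem : ∀ t ∈ Icc 0 b.toReal, x t ∈ D := fun t ht =>
      mem_of_lt_exitTime ht.1 ((ofReal_le_of_le_toReal ht.2).trans_lt hb)
    filter_upwards [eventually_forall_mem_of_tendstoUniformlyOn isCompact_Icc hD
      (hx.mono Icc_subset_Ici_self) (hconv _ hbpos) hmem] with n hn
    have hle := le_exitTime_of_forall_mem hn
    rw [ofReal_toReal hbtop] at hle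
    exact hab.trans_le hle
  · obtain ⟨s, hs, hsa, hxs⟩ := exists_notMem_closure_of_exitTime_lt hD h0 hgraze ha
    have hlim := (hconv s hs).tendsto_at (right_mem_Icc.2 hs.le)
    filter_upwards [hlim.eventually_mem (isClosed_closure.isOpen_compl.mem_nhds hxs)] with n hn
    exact (exitTime_le_ofReal hs.le fun h => hn (subset_closure h)).trans_lt hsa
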